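/- Fix ω ∈ (0,2π). Define, for z in the closed sector |arg z| ≤ ω/2 minus the origin, v^{−1}(z) = (sin ω/π) z log z + ((ω − π)/π) z̄ log z̄ − (cos ω) z + z̄ log z, and, for z₊ in the closed sector |arg z₊| ≤ π − ω/2 minus the origin, w^{−1}(z₊) = −(sin ω/π) z₊ log z₊ − (ω/π) z̄₊ log z̄₊ + z̄₊. Then the pair (v^{−1}, w^{−1}) solves the transmission problem: ∂_z∂_{z̄} v^{−1}(z) = z^{−1} for all z ∈ S₋; ∂_{z₊}∂_{z̄₊} w^{−1}(z₊) = 0 for all z₊ with |arg z₊| < π − ω/2; and for all z ∈ Γ, ∂_z v^{−1}(z) + (∂_{z₊} w^{−1})(−z) = 0 and ∂_{z̄} v^{−1}(z) + (∂_{z̄₊} w^{−1})(−z) = 0. -/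

import Mathlib

open Complex ComplexConjugate Filter Set
open scoped Real

noncomputable section

/-- The Wirtinger derivative `∂_z f = ½(∂_x f − i ∂_y f)`. -/
def wdz (f : ℂ → ℂ) (z : ℂ) : ℂ :=
  (fderiv ℝ f z 1 - I * fderiv ℝ f z I) / 2

/-- The Wirtinger derivative `∂_{z̄} f = ½(∂_x f + i ∂_y f)`. -/
def wdzbar (f : ℂ → ℂ) (z : ℂ) : ℂ :=
  (fderiv ℝ f z 1 + I * fderiv ℝ f z I) / 2

/-- The open sector `S₋ = {r e^{iθ} : r > 0, |θ| < ω/2}`. -/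
def Sminus (ω : ℝ) : Set ℂ := {z | z ≠ 0 ∧ |z.arg| < ω / 2}

/-- The open sector of the variable `z₊ = −z`, i.e. `{z₊ ≠ 0 : |arg z₊| < π − ω/2}`,
corresponding to the interior of `S₊`. -/
def SplusVar (ω : ℝ) : Set ℂ := {z | z ≠ 0 ∧ |z.arg| < π - ω / 2}

/-- The common boundary `Γ = {r e^{±iω/2} : r > 0}`. -/
def Gam (ω : ℝ) : Set ℂ := {z | z ≠ 0 ∧ |z.arg| = ω / 2}

/-- `f` is real-differentiable at `z` with Wirtinger derivatives `∂_z f = a` and `∂_{z̄} f = b`. -/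
def HasWirtingerAt (f : ℂ → ℂ) (a b z : ℂ) : Prop :=
  HasFDerivAt f (a • ContinuousLinearMap.id ℝ ℂ + b • (conjCLE : ℂ →L[ℝ] ℂ)) z

namespace HasWirtingerAt

variable {f g : ℂ → ℂ} {a b c d z : ℂ}

theorem wdz_eq (h : HasWirtingerAt f a b z) : wdz f z = a := by
  unfold HasWirtingerAt at h
  rw [wdz, h.fderiv]
  simp
  linear_combination (b - a) / 2 * I_mul_I

theorem wdzbar_eq (h : HasWirtingerAt f a b z) : wdzbar f z = b := by
  unfold HasWirtingerAt at h
  rw [wdzbar, h.fderiv]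
  simp
  linear_combination (a - b) / 2 * I_mul_I

theorem add (hf : HasWirtingerAt f a b z) (hg : HasWirtingerAt g c d z) :
    HasWirtingerAt (fun x => f x + g x) (a + c) (b + d) z := by
  refine (HasFDerivAt.add hf hg).congr_fderiv ?_
  module

theorem mul (hf : HasWirtingerAt f a b z) (hg : HasWirtingerAt g c d z) :
    HasWirtingerAt (fun x => f x * g x) (a * g z + f z * c) (b * g z + f z * d) z := by
  refine (HasFDerivAt.mul hf hg).congr_fderiv ?_
  module

theorem of_hasDerivAt (h : HasDerivAt f a z) : HasWirtingerAt f a 0 z := by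
  refine (h.hasFDerivAt.restrictScalars ℝ).congr_fderiv ?_
  ext
  simp [mul_comm]

theorem comp_conj (h : HasDerivAt f a (conj z)) :
    HasWirtingerAt (fun x => f (conj x)) 0 a z := by
  refine ((h.hasFDerivAt.restrictScalars ℝ).comp z
    (conjCLE : ℂ →L[ℝ] ℂ).hasFDerivAt).congr_fderiv ?_
  ext
  simp [mul_comm]

theorem const (c z : ℂ) : HasWirtingerAt (fun _ => c) 0 0 z :=
  of_hasDerivAt (hasDerivAt_const z c)

theorem self (z : ℂ) : HasWirtingerAt (fun x => x) 1 0 z :=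
  of_hasDerivAt (hasDerivAt_id z)

theorem conj_self (z : ℂ) : HasWirtingerAt (fun x => conj x) 0 1 z :=
  comp_conj (hasDerivAt_id _)

theorem clog (hz : z ∈ slitPlane) : HasWirtingerAt Complex.log z⁻¹ 0 z :=
  of_hasDerivAt (hasDerivAt_log hz)

theorem clog_conj (hz : z ∈ slitPlane) :
    HasWirtingerAt (fun x => Complex.log (conj x)) 0 (conj z)⁻¹ z := by
  refine comp_conj (hasDerivAt_log ?_)
  rw [mem_slitPlane_iff] at hz ⊢
  simpa using hz

end HasWirtingerAt

theorem wdz_congr {f g : ℂ → ℂ} {z : ℂ} (h : f =ᶠ[nhds z] g) : wdz f z = wdz g z := by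
  rw [wdz, wdz, h.fderiv_eq]

theorem mem_slitPlane_of_abs_arg_lt_pi {z : ℂ} (h0 : z ≠ 0) (h : |z.arg| < π) :
    z ∈ slitPlane :=
  mem_slitPlane_iff_arg.2 ⟨fun e => by simp [e, abs_of_pos Real.pi_pos] at h, h0⟩

/-- On the slit plane, `p z log z + q z̄ log z̄ + k z + l z̄ log z + m z̄` has the expected
Wirtinger derivatives. -/
theorem hasWirtingerAt_shadow (p q k l m : ℂ) {z : ℂ} (hz : z ∈ slitPlane) :
    HasWirtingerAt
      (fun z => p * z * Complex.log z + q * conj z * Complex.log (conj z) + k * z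
        + l * (conj z * Complex.log z) + m * conj z)
      (p * (Complex.log z + 1) + k + l * (conj z / z))
      (q * (Complex.log (conj z) + 1) + l * Complex.log z + m) z := by
  have h0 : z ≠ 0 := slitPlane_ne_zero hz
  have h0' : conj z ≠ 0 := by simpa using h0
  have hid := HasWirtingerAt.self z
  have hconj := HasWirtingerAt.conj_self z
  have hc := fun c => HasWirtingerAt.const c z
  have hlog := HasWirtingerAt.clog hz
  have hlogc := HasWirtingerAt.clog_conj hz
  have h := (((((hc p).mul hid).mul hlog).add (((hc q).mul hconj).mul hlogc)).add
    ((hc k).mul hid)).add ((hc l).mul (hconj.mul hlog)) |>.add ((hc m).mul hconj)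
  convert h using 1 <;> field_simp <;> ring

/-- The mixed derivative `∂_z ∂_{z̄}` of `p z log z + q z̄ log z̄ + k z + l z̄ log z + m z̄`. -/
theorem wdz_wdzbar_shadow (p q k l m : ℂ) {z : ℂ} (hz : z ∈ slitPlane) :
    wdz (wdzbar (fun z => p * z * Complex.log z + q * conj z * Complex.log (conj z) + k * z
        + l * (conj z * Complex.log z) + m * conj z)) z = l * z⁻¹ := by
  have hev : wdzbar (fun z => p * z * Complex.log z + q * conj z * Complex.log (conj z) + k * z
        + l * (conj z * Complex.log z) + m * conj z) =ᶠ[nhds z]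
      fun z => q * (Complex.log (conj z) + 1) + l * Complex.log z + m := by
    filter_upwards [isOpen_slitPlane.mem_nhds hz] with x hx
    exact (hasWirtingerAt_shadow p q k l m hx).wdzbar_eq
  have hc := fun c => HasWirtingerAt.const c z
  rw [wdz_congr hev, ((((hc q).mul ((HasWirtingerAt.clog_conj hz).add (hc 1))).add
    ((hc l).mul (HasWirtingerAt.clog hz))).add (hc m)).wdz_eq]
  ring

/-- On the ray `arg z = εω/2` of `Γ`, with `ε = ±1`, one has `arg (-z) = arg z - επ`. -/
theorem exists_sign_of_mem_Gam {ω : ℝ} (hω : ω ∈ Ioo 0 (2 * π)) {z : ℂ} (hz : z ∈ Gam ω) :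
    ∃ ε : ℝ, (ε = 1 ∨ ε = -1) ∧ z.arg = ε * (ω / 2) ∧ (-z).arg = z.arg - ε * π := by
  obtain ⟨h0, h⟩ := hz
  obtain ⟨hω0, hω2⟩ := hω
  have hsin : Real.sin (ω / 2) > 0 := Real.sin_pos_of_pos_of_lt_pi (by linarith) (by linarith)
  have hn : 0 < ‖z‖ := norm_pos_iff.2 h0
  rcases eq_or_eq_neg_of_abs_eq h with h | h
  · refine ⟨1, Or.inl rfl, by rw [h]; ring, ?_⟩
    rw [arg_neg_eq_arg_sub_pi_of_im_pos, one_mul]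
    rw [← norm_mul_sin_arg, h]
    positivity
  · refine ⟨-1, Or.inr rfl, by rw [h]; ring, ?_⟩
    rw [arg_neg_eq_arg_add_pi_of_im_neg]
    · ring
    · rw [← norm_mul_sin_arg, h, Real.sin_neg]
      nlinarith

/-- The first-order shadow generated by `z^{−1}` (Proposition `prop:k-1`). -/
theorem stmt11 (ω : ℝ) (hω : ω ∈ Ioo 0 (2 * π))
    (v w : ℂ → ℂ)
    (hv : ∀ z : ℂ, v z =
      ((Real.sin ω : ℂ) / (π : ℂ)) * z * Complex.log z
      + (((ω : ℂ) - π) / (π : ℂ)) * conj z * Complex.log (conj z)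
      - (Real.cos ω : ℂ) * z
      + conj z * Complex.log z)
    (hw : ∀ z : ℂ, w z =
      -((Real.sin ω : ℂ) / (π : ℂ)) * z * Complex.log z
      - ((ω : ℂ) / (π : ℂ)) * conj z * Complex.log (conj z)
      + conj z) :
    (∀ z ∈ Sminus ω, wdz (wdzbar v) z = z ^ (-1 : ℤ)) ∧
    (∀ zp ∈ SplusVar ω, wdz (wdzbar w) zp = 0) ∧
    (∀ z ∈ Gam ω, wdz v z + wdz w (-z) = 0 ∧ wdzbar v z + wdzbar w (-z) = 0) := by
  have hv' : v = fun z => ((Real.sin ω : ℂ) / π) * z * Complex.log z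
      + (((ω : ℂ) - π) / π) * conj z * Complex.log (conj z) + (-(Real.cos ω : ℂ)) * z
      + 1 * (conj z * Complex.log z) + 0 * conj z := by
    funext z
    rw [hv]
    ring
  have hw' : w = fun z => (-((Real.sin ω : ℂ) / π)) * z * Complex.log z
      + (-((ω : ℂ) / π)) * conj z * Complex.log (conj z) + 0 * z
      + 0 * (conj z * Complex.log z) + 1 * conj z := by
    funext z
    rw [hw]
    ring
  have hω' := hω
  obtain ⟨hω0, hω2⟩ := hω'
  refine ⟨fun z hz => ?_, fun z hz => ?_, fun z hz => ?_⟩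
  · rw [hv', wdz_wdzbar_shadow _ _ _ _ _
      (mem_slitPlane_of_abs_arg_lt_pi hz.1 (hz.2.trans (by linarith)))]
    simp
  · rw [hw', wdz_wdzbar_shadow _ _ _ _ _
      (mem_slitPlane_of_abs_arg_lt_pi hz.1 (hz.2.trans (by linarith)))]
    simp
  · obtain ⟨ε, hε, harg, hargn⟩ := exists_sign_of_mem_Gam hω hz
    have hzs : z ∈ slitPlane :=
      mem_slitPlane_of_abs_arg_lt_pi hz.1 (by rw [hz.2]; linarith)
    have hns : -z ∈ slitPlane := by
      refine mem_slitPlane_of_abs_arg_lt_pi (neg_ne_zero.2 hz.1) ?_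
      rw [hargn, harg, abs_lt]
      rcases hε with rfl | rfl <;> constructor <;> linarith
    have hπ : (π : ℂ) ≠ 0 := ofReal_ne_zero.2 Real.pi_ne_zero
    have hlogn : Complex.log (-z) = Complex.log z - ε * π * I := by
      rw [Complex.log, Complex.log, hargn, norm_neg]
      push_cast
      ring
    have hlogc : Complex.log (conj z) = Complex.log z - ε * ω * I := by
      rw [Complex.log_conj _ (mem_slitPlane_iff_arg.1 hzs).1, Complex.log, harg]
      simp only [map_add, map_mul, conj_ofReal, conj_I]
      push_cast
      ring
    have hlognc : Complex.log (conj (-z)) = Complex.log z - ε * ω * I + ε * π * I := by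
      rw [Complex.log_conj _ (mem_slitPlane_iff_arg.1 hns).1, hlogn, map_sub,
        ← Complex.log_conj _ (mem_slitPlane_iff_arg.1 hzs).1, hlogc]
      simp
    have hratio : conj z / z = Real.cos ω - ε * Real.sin ω * I := by
      have hexp : conj z / z = exp (Complex.log (conj z) - Complex.log z) := by
        rw [exp_sub, exp_log hz.1, exp_log ((map_ne_zero (starRingEnd ℂ)).2 hz.1)]
      rw [hexp, hlogc]
      have : Complex.log z - ε * ω * I - Complex.log z = ((-(ε * ω) : ℝ) : ℂ) * I := by
        push_cast
        ring
      rw [this, exp_mul_I, ← ofReal_cos, ← ofReal_sin]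
      rcases hε with rfl | rfl
      · simp
        ring
      · simp
    have hV := hasWirtingerAt_shadow ((Real.sin ω : ℂ) / π) (((ω : ℂ) - π) / π)
      (-(Real.cos ω : ℂ)) 1 0 hzs
    have hW := hasWirtingerAt_shadow (-((Real.sin ω : ℂ) / π)) (-((ω : ℂ) / π)) 0 0 1 hns
    rw [← hv'] at hV
    rw [← hw'] at hW
    rw [hV.wdz_eq, hW.wdz_eq, hV.wdzbar_eq, hW.wdzbar_eq, hratio, hlogn, hlognc, hlogc]
    constructor <;> field_simp <;> ring
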